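/- Let φ⁺ be the principal eigenfunction. For each 0 < a < 1/(4Λ), there exists a constant C > 0 such that φ⁺(y) ≤ C exp(−a|y|²) for all y ∈ ℝⁿ. Likewise, for each a > 1/(4λ), there exists a constant C > 0 such that exp(−a|y|²) ≤ C φ⁺(y) for all y ∈ ℝⁿ. -/

import Mathlib

noncomputable section

open Filter Matrix Real Set
open scoped Topology

/-- Euclidean `n`-space `ℝⁿ`. -/
abbrev En (n : ℕ) := EuclideanSpace ℝ (Fin n)

/-- `n × n` real matrices. -/
abbrev Mat (n : ℕ) := Matrix (Fin n) (Fin n) ℝ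

/-- The set of symmetric positive definite matrices whose eigenvalues all lie in `[lam, Lam]`. -/
def PucciMatrices (n : ℕ) (lam Lam : ℝ) : Set (Mat n) :=
  { A | ∃ hA : A.IsHermitian, ∀ i, hA.eigenvalues i ∈ Set.Icc lam Lam }

/-- The Pucci maximal operator `P⁺(M) = sup {-tr(AM) : A ∈ PucciMatrices}`. -/
def PucciPlus (n : ℕ) (lam Lam : ℝ) (M : Mat n) : ℝ :=
  sSup ((fun A => -(A * M).trace) '' PucciMatrices n lam Lam)

/-- The Pucci minimal operator `P⁻(M) = inf {-tr(AM) : A ∈ PucciMatrices}`. -/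
def PucciMinus (n : ℕ) (lam Lam : ℝ) (M : Mat n) : ℝ :=
  sInf ((fun A => -(A * M).trace) '' PucciMatrices n lam Lam)

/-- `F` is uniformly elliptic with ellipticity constants `lam ≤ Lam`. -/
def UniformlyElliptic (n : ℕ) (lam Lam : ℝ) (F : Mat n → ℝ) : Prop :=
  ∀ M N : Mat n, M.IsSymm → N.IsSymm →
    PucciMinus n lam Lam (M - N) ≤ F M - F N ∧ F M - F N ≤ PucciPlus n lam Lam (M - N)

/-- `F` is positively homogeneous of order one. -/
def PositivelyHomogeneous (n : ℕ) (F : Mat n → ℝ) : Prop :=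
  ∀ (M : Mat n), ∀ η : ℝ, 0 ≤ η → F (η • M) = η * F M

/-- The Hessian matrix of `φ : ℝⁿ → ℝ` at a point `y`. -/
def hess (n : ℕ) (φ : En n → ℝ) (y : En n) : Mat n :=
  Matrix.of fun i j =>
    fderiv ℝ (fun z => fderiv ℝ φ z (EuclideanSpace.single j 1)) y (EuclideanSpace.single i 1)

/-- Viscosity subsolution of the elliptic equation `G(D²u, Du, u, y) = 0` on `Ω`,
i.e. `G[u] ≤ 0` in the viscosity sense. -/
def ViscSubE (n : ℕ) (Ω : Set (En n))
    (G : Mat n → (En n →L[ℝ] ℝ) → ℝ → En n → ℝ) (u : En n → ℝ) : Prop :=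
  ∀ y ∈ Ω, ∀ φ : En n → ℝ, ContDiff ℝ 2 φ →
    IsLocalMaxOn (fun z => u z - φ z) Ω y →
    G (hess n φ y) (fderiv ℝ φ y) (u y) y ≤ 0

/-- Viscosity supersolution of the elliptic equation `G(D²u, Du, u, y) = 0` on `Ω`,
i.e. `G[u] ≥ 0` in the viscosity sense. -/
def ViscSupE (n : ℕ) (Ω : Set (En n))
    (G : Mat n → (En n →L[ℝ] ℝ) → ℝ → En n → ℝ) (u : En n → ℝ) : Prop :=
  ∀ y ∈ Ω, ∀ φ : En n → ℝ, ContDiff ℝ 2 φ →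
    IsLocalMinOn (fun z => u z - φ z) Ω y →
    0 ≤ G (hess n φ y) (fderiv ℝ φ y) (u y) y

/-- Viscosity solution of the elliptic equation `G(D²u, Du, u, y) = 0` on `Ω`. -/
def ViscSolE (n : ℕ) (Ω : Set (En n))
    (G : Mat n → (En n →L[ℝ] ℝ) → ℝ → En n → ℝ) (u : En n → ℝ) : Prop :=
  ViscSubE n Ω G u ∧ ViscSupE n Ω G u

/-- Time derivative of `φ : ℝⁿ × ℝ → ℝ` at `p = (x, t)`. -/
def tderiv (n : ℕ) (φ : En n × ℝ → ℝ) (p : En n × ℝ) : ℝ :=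
  deriv (fun s => φ (p.1, s)) p.2

/-- Spatial Hessian of `φ : ℝⁿ × ℝ → ℝ` at `p = (x, t)`. -/
def shess (n : ℕ) (φ : En n × ℝ → ℝ) (p : En n × ℝ) : Mat n :=
  hess n (fun z => φ (z, p.2)) p.1

/-- Spatial differential of `φ : ℝⁿ × ℝ → ℝ` at `p = (x, t)`. -/
def sgrad (n : ℕ) (φ : En n × ℝ → ℝ) (p : En n × ℝ) : En n →L[ℝ] ℝ :=
  fderiv ℝ (fun z => φ (z, p.2)) p.1

/-- Viscosity subsolution of the parabolic equation `u_t + G(D²u, Du, u, (x,t)) = 0` on `Ω`. -/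
def ViscSubP (n : ℕ) (Ω : Set (En n × ℝ))
    (G : Mat n → (En n →L[ℝ] ℝ) → ℝ → En n × ℝ → ℝ) (u : En n × ℝ → ℝ) : Prop :=
  ∀ p ∈ Ω, ∀ φ : En n × ℝ → ℝ, ContDiff ℝ 2 φ →
    IsLocalMaxOn (fun q => u q - φ q) Ω p →
    tderiv n φ p + G (shess n φ p) (sgrad n φ p) (u p) p ≤ 0

/-- Viscosity supersolution of the parabolic equation `u_t + G(D²u, Du, u, (x,t)) = 0` on `Ω`. -/
def ViscSupP (n : ℕ) (Ω : Set (En n × ℝ))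
    (G : Mat n → (En n →L[ℝ] ℝ) → ℝ → En n × ℝ → ℝ) (u : En n × ℝ → ℝ) : Prop :=
  ∀ p ∈ Ω, ∀ φ : En n × ℝ → ℝ, ContDiff ℝ 2 φ →
    IsLocalMinOn (fun q => u q - φ q) Ω p →
    0 ≤ tderiv n φ p + G (shess n φ p) (sgrad n φ p) (u p) p

/-- Viscosity solution of the parabolic equation `u_t + G(D²u, Du, u, (x,t)) = 0` on `Ω`. -/
def ViscSolP (n : ℕ) (Ω : Set (En n × ℝ))
    (G : Mat n → (En n →L[ℝ] ℝ) → ℝ → En n × ℝ → ℝ) (u : En n × ℝ → ℝ) : Prop :=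
  ViscSubP n Ω G u ∧ ViscSupP n Ω G u

/-- The parabolic domain `ℝⁿ × ℝ₊`. -/
def Qset (n : ℕ) : Set (En n × ℝ) := {p | 0 < p.2}

/-- The elliptic operator `F(D²u) - (1/2) y·Du - α u - f(y)`. -/
def Fop (n : ℕ) (F : Mat n → ℝ) (α : ℝ) (f : En n → ℝ) :
    Mat n → (En n →L[ℝ] ℝ) → ℝ → En n → ℝ :=
  fun M p v y => F M - (1/2) * p y - α * v - f y

/-- Membership in the space `X` with weight `b`: continuity and finiteness of the norm. -/
def memX (n : ℕ) (b : ℝ) (u : En n → ℝ) : Prop :=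
  Continuous u ∧ BddAbove (Set.range fun y : En n => |u y| * Real.exp (b * ‖y‖ ^ 2) / (1 + ‖y‖ ^ 2))

/-- The norm `‖u‖_X = sup_y |u(y)| e^{b|y|²} / (1 + |y|²)`. -/
def normX (n : ℕ) (b : ℝ) (u : En n → ℝ) : ℝ :=
  sSup (Set.range fun y : En n => |u y| * Real.exp (b * ‖y‖ ^ 2) / (1 + ‖y‖ ^ 2))

/-- The positive anomalous exponent `α⁺(F)`. -/
def alphaPlus (n : ℕ) (lam Lam : ℝ) (F : Mat n → ℝ) : ℝ :=
  sSup { α : ℝ | ∃ φ : En n → ℝ, memX n (1/(8*Lam)) φ ∧ (∀ y, 0 ≤ φ y) ∧ φ ≠ 0 ∧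
    ViscSupE n Set.univ (Fop n F α (fun _ => 0)) φ }

/-- `Φ` is a positive self-similar solution of `u_t + F(D²u) = 0` with exponent `α`,
with a Gaussian upper bound at time one. -/
def IsSelfSimilarPlus (n : ℕ) (F : Mat n → ℝ) (α : ℝ) (Φ : En n × ℝ → ℝ) : Prop :=
  ContinuousOn Φ (Qset n) ∧
  (∀ p ∈ Qset n, 0 < Φ p) ∧
  ViscSolP n (Qset n) (fun M _ _ _ => F M) Φ ∧
  (∀ σ : ℝ, 0 < σ → ∀ x : En n, ∀ t : ℝ, 0 < t →
    Φ (x, t) = σ ^ α * Φ (Real.sqrt σ • x, σ * t)) ∧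
  (∃ C : ℝ, 0 < C ∧ ∃ a : ℝ, 0 < a ∧ ∀ x : En n, Φ (x, 1) ≤ C * Real.exp (-a * ‖x‖ ^ 2))

/-- `Φ` is a negative self-similar solution of `u_t + F(D²u) = 0` with exponent `α`,
with a Gaussian lower bound at time one. -/
def IsSelfSimilarMinus (n : ℕ) (F : Mat n → ℝ) (α : ℝ) (Φ : En n × ℝ → ℝ) : Prop :=
  ContinuousOn Φ (Qset n) ∧
  (∀ p ∈ Qset n, Φ p < 0) ∧
  ViscSolP n (Qset n) (fun M _ _ _ => F M) Φ ∧
  (∀ σ : ℝ, 0 < σ → ∀ x : En n, ∀ t : ℝ, 0 < t →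
    Φ (x, t) = σ ^ α * Φ (Real.sqrt σ • x, σ * t)) ∧
  (∃ C : ℝ, 0 < C ∧ ∃ a : ℝ, 0 < a ∧ ∀ x : En n, -Φ (x, 1) ≤ C * Real.exp (-a * ‖x‖ ^ 2))

/-- The set `S` of locally uniform sequential limits of the rescalings
`u^σ(x,t) = σ^α u(σ^{1/2} x, σ t)` as `σ → ∞`. -/
def limitSet (n : ℕ) (α : ℝ) (u : En n × ℝ → ℝ) : Set (En n × ℝ → ℝ) :=
  { U | ContinuousOn U (Qset n) ∧ ∃ σ : ℕ → ℝ,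
      Tendsto σ atTop atTop ∧
      TendstoLocallyUniformlyOn
        (fun k (p : En n × ℝ) => (σ k) ^ α * u (Real.sqrt (σ k) • p.1, σ k * p.2))
        U atTop (Qset n) }

/-- A linear combination of two centred Gaussians. -/
def gaussPair (n : ℕ) (a b c d : ℝ) (y : En n) : ℝ :=
  c * Real.exp (-a * ‖y‖ ^ 2) + d * Real.exp (-b * ‖y‖ ^ 2)

theorem contDiff_gaussPair (n : ℕ) (a b c d : ℝ) : ContDiff ℝ 2 (gaussPair n a b c d) := by
  unfold gaussPair
  have h : ContDiff ℝ 2 (fun y : En n => ‖y‖ ^ 2) := contDiff_norm_sq ℝ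
  fun_prop

theorem hasFDerivAt_exp_norm_sq (n : ℕ) (a : ℝ) (y : En n) :
    HasFDerivAt (fun y : En n => Real.exp (-a * ‖y‖ ^ 2))
      ((-2 * a * Real.exp (-a * ‖y‖ ^ 2)) • innerSL ℝ y) y := by
  have h : HasFDerivAt (fun y : En n => ‖y‖ ^ 2) (2 • innerSL ℝ y) y :=
    (hasStrictFDerivAt_norm_sq y).hasFDerivAt
  refine (h.const_mul (-a)).exp.congr_fderiv ?_
  ext v
  simp
  ring

theorem fderiv_gaussPair (n : ℕ) (a b c d : ℝ) (y v : En n) :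
    fderiv ℝ (gaussPair n a b c d) y v =
      (-2 * a * c * Real.exp (-a * ‖y‖ ^ 2) - 2 * b * d * Real.exp (-b * ‖y‖ ^ 2)) *
        inner ℝ y v := by
  have h : HasFDerivAt (gaussPair n a b c d) _ y :=
    ((hasFDerivAt_exp_norm_sq n a y).const_mul c).add
      ((hasFDerivAt_exp_norm_sq n b y).const_mul d)
  rw [h.fderiv]
  simp
  ring

theorem hess_gaussPair (n : ℕ) (a b c d : ℝ) (y : En n) :
    hess n (gaussPair n a b c d) y =
      (4 * a ^ 2 * c * Real.exp (-a * ‖y‖ ^ 2) + 4 * b ^ 2 * d * Real.exp (-b * ‖y‖ ^ 2)) •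
        Matrix.vecMulVec y y -
      (2 * a * c * Real.exp (-a * ‖y‖ ^ 2) + 2 * b * d * Real.exp (-b * ‖y‖ ^ 2)) •
        (1 : Mat n) := by
  ext i j
  have hj : HasFDerivAt (fun z : En n => z j) (EuclideanSpace.proj j : En n →L[ℝ] ℝ) y :=
    (EuclideanSpace.proj j : En n →L[ℝ] ℝ).hasFDerivAt
  have h := (((hasFDerivAt_exp_norm_sq n a y).const_mul (-2 * a * c)).sub
      ((hasFDerivAt_exp_norm_sq n b y).const_mul (2 * b * d))).mul hj
  have he : (fun z => fderiv ℝ (gaussPair n a b c d) z (EuclideanSpace.single j 1)) =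
      fun z : En n => (-2 * a * c * Real.exp (-a * ‖z‖ ^ 2)
        - 2 * b * d * Real.exp (-b * ‖z‖ ^ 2)) * z j := by
    funext z
    rw [fderiv_gaussPair, EuclideanSpace.inner_single_right]
    simp
  simp only [hess, Matrix.of_apply, he]
  erw [h.fderiv]
  by_cases hij : i = j
  · subst hij
    simp [Matrix.vecMulVec_apply, EuclideanSpace.inner_single_right]
    ring
  · simp [Matrix.vecMulVec_apply, hij, Ne.symm hij, EuclideanSpace.inner_single_right]
    ring

theorem isSymm_hess_gaussPair (n : ℕ) (a b c d : ℝ) (y : En n) :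
    (hess n (gaussPair n a b c d) y).IsSymm := by
  rw [hess_gaussPair]
  ext i j
  by_cases hij : i = j
  · subst hij; rfl
  · simp [Matrix.vecMulVec_apply, hij, Ne.symm hij, mul_comm]

theorem pucciMatrices_nonempty (n : ℕ) {lam Lam : ℝ} (h : lam ≤ Lam) :
    (PucciMatrices n lam Lam).Nonempty := by
  have hA : (lam • (1 : Mat n)).IsHermitian := by
    simp [Matrix.IsHermitian]
  refine ⟨_, hA, fun i => ?_⟩
  have h1 := hA.mulVec_eigenvectorBasis i
  have h2 : hA.eigenvectorBasis i ≠ 0 := hA.eigenvectorBasis.orthonormal.ne_zero i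
  have h3 : hA.eigenvalues i = lam := by
    by_contra hne
    apply h2
    ext k
    have := congrFun h1 k
    simp [Matrix.smul_mulVec] at this
    rcases this with h | h
    · exact absurd h.symm hne
    · simpa using h
  rw [h3]
  exact ⟨le_rfl, h⟩

theorem posSemidef_of_mem_pucciMatrices {n : ℕ} {lam Lam : ℝ} {A : Mat n}
    (hA : A ∈ PucciMatrices n lam Lam) :
    (A - lam • (1 : Mat n)).PosSemidef ∧ (Lam • (1 : Mat n) - A).PosSemidef := by
  obtain ⟨hA, h⟩ := hA
  have hspec : ∀ μ ∈ spectrum ℝ A, μ ∈ Set.Icc lam Lam := by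
    rw [hA.spectrum_real_eq_range_eigenvalues]
    rintro _ ⟨i, rfl⟩
    exact h i
  have hone : ∀ s : ℝ, (s • (1 : Mat n)).IsHermitian := fun s => by simp [Matrix.IsHermitian]
  constructor
  · rw [(hA.sub (hone lam)).posSemidef_iff_eigenvalues_nonneg]
    intro i
    have hi := (hA.sub (hone lam)).eigenvalues_mem_spectrum_real i
    generalize (hA.sub (hone lam)).eigenvalues i = ν at hi ⊢
    rw [← Algebra.algebraMap_eq_smul_one, ← spectrum.sub_singleton_eq] at hi
    obtain ⟨μ, hμ, _, rfl, he⟩ := hi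
    have := (hspec μ hμ).1
    simp only [Pi.zero_apply]
    linarith
  · rw [((hone Lam).sub hA).posSemidef_iff_eigenvalues_nonneg]
    intro i
    have hi := ((hone Lam).sub hA).eigenvalues_mem_spectrum_real i
    generalize ((hone Lam).sub hA).eigenvalues i = ν at hi ⊢
    rw [← Algebra.algebraMap_eq_smul_one, ← spectrum.singleton_sub_eq] at hi
    obtain ⟨_, rfl, μ, hμ, he⟩ := hi
    have := (hspec μ hμ).2
    simp only [Pi.zero_apply]
    linarith

theorem dotProduct_mulVec_mem_Icc {n : ℕ} {lam Lam : ℝ} {A : Mat n}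
    (hA : A ∈ PucciMatrices n lam Lam) (y : En n) :
    y.ofLp ⬝ᵥ A *ᵥ y.ofLp ∈ Set.Icc (lam * ‖y‖ ^ 2) (Lam * ‖y‖ ^ 2) := by
  obtain ⟨h1, h2⟩ := posSemidef_of_mem_pucciMatrices hA
  have hy : ‖y‖ ^ 2 = y.ofLp ⬝ᵥ y.ofLp := by
    rw [← real_inner_self_eq_norm_sq]; rfl
  have h1 := h1.dotProduct_mulVec_nonneg y.ofLp
  have h2 := h2.dotProduct_mulVec_nonneg y.ofLp
  simp [Matrix.sub_mulVec, Matrix.smul_mulVec] at h1 h2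
  rw [hy]
  exact ⟨h1, h2⟩

theorem trace_mem_Icc {n : ℕ} {lam Lam : ℝ} {A : Mat n} (hA : A ∈ PucciMatrices n lam Lam) :
    A.trace ∈ Set.Icc (n * lam) (n * Lam) := by
  obtain ⟨hA, h⟩ := hA
  rw [hA.trace_eq_sum_eigenvalues]
  constructor
  · simpa using Finset.card_nsmul_le_sum Finset.univ (fun i => hA.eigenvalues i) lam
      fun i _ => (h i).1
  · simpa using Finset.sum_le_card_nsmul Finset.univ (fun i => hA.eigenvalues i) Lam
      fun i _ => (h i).2

theorem trace_mul_hess_gaussPair {n : ℕ} (a b c d : ℝ) (y : En n) (A : Mat n) :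
    -(A * hess n (gaussPair n a b c d) y).trace =
      c * Real.exp (-a * ‖y‖ ^ 2) * (-4 * a ^ 2 * (y.ofLp ⬝ᵥ A *ᵥ y.ofLp) + 2 * a * A.trace) +
      d * Real.exp (-b * ‖y‖ ^ 2) * (-4 * b ^ 2 * (y.ofLp ⬝ᵥ A *ᵥ y.ofLp) + 2 * b * A.trace) := by
  rw [hess_gaussPair, mul_sub, Matrix.trace_sub, Matrix.mul_smul, Matrix.mul_smul,
    Matrix.trace_smul, Matrix.trace_smul, Matrix.mul_vecMulVec, Matrix.trace_vecMulVec,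
    dotProduct_comm]
  simp
  ring

theorem pucci_bounds {n : ℕ} {lam Lam : ℝ} (hLam : lam ≤ Lam) {F : Mat n → ℝ}
    (hF : UniformlyElliptic n lam Lam F) (hFh : PositivelyHomogeneous n F) {M : Mat n}
    (hM : M.IsSymm) (m : ℝ) :
    ((∀ A ∈ PucciMatrices n lam Lam, m ≤ -(A * M).trace) → m ≤ F M) ∧
    ((∀ A ∈ PucciMatrices n lam Lam, -(A * M).trace ≤ m) → F M ≤ m) := by
  have hF0 : F 0 = 0 := by simpa using hFh 0 0 le_rfl
  have h := hF M 0 hM (by simp [Matrix.IsSymm])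
  rw [sub_zero, hF0, sub_zero] at h
  have hne := (pucciMatrices_nonempty n hLam).image (fun A => -(A * M).trace)
  refine ⟨fun hm => le_trans (le_csInf hne ?_) h.1, fun hm => h.2.trans (csSup_le hne ?_)⟩
  · rintro _ ⟨A, hA, rfl⟩; exact hm A hA
  · rintro _ ⟨A, hA, rfl⟩; exact hm A hA

theorem le_elliptic_gaussPair {n : ℕ} {lam Lam : ℝ} (hlam : 0 < lam) (hLam : lam ≤ Lam)
    {F : Mat n → ℝ} (hF : UniformlyElliptic n lam Lam F) (hFh : PositivelyHomogeneous n F)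
    {a b c d : ℝ} (ha : 0 ≤ a) (hb : 0 ≤ b) (hc : 0 ≤ c) (hd : 0 ≤ d) (y : En n) :
    c * Real.exp (-a * ‖y‖ ^ 2) * (-4 * a ^ 2 * (Lam * ‖y‖ ^ 2)) +
      d * Real.exp (-b * ‖y‖ ^ 2) * (-4 * b ^ 2 * (Lam * ‖y‖ ^ 2)) ≤
    F (hess n (gaussPair n a b c d) y) := by
  refine (pucci_bounds hLam hF hFh (isSymm_hess_gaussPair n a b c d y) _).1 fun A hA => ?_
  rw [trace_mul_hess_gaussPair]
  have h1 := (dotProduct_mulVec_mem_Icc hA y).2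
  have h2 : 0 ≤ A.trace := le_trans (by positivity) (trace_mem_Icc hA).1
  have key : ∀ s : ℝ, 0 ≤ s → -4 * s ^ 2 * (Lam * ‖y‖ ^ 2) ≤
      -4 * s ^ 2 * (y.ofLp ⬝ᵥ A *ᵥ y.ofLp) + 2 * s * A.trace := fun s hs => by
    have := mul_le_mul_of_nonneg_left h1 (by positivity : 0 ≤ 4 * s ^ 2)
    have : 0 ≤ 2 * s * A.trace := by positivity
    linarith
  gcongr ?_ * ?_ + ?_ * ?_
  · exact key a ha
  · exact key b hb

theorem elliptic_gaussPair_le {n : ℕ} {lam Lam : ℝ} (hlam : 0 < lam) (hLam : lam ≤ Lam)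
    {F : Mat n → ℝ} (hF : UniformlyElliptic n lam Lam F) (hFh : PositivelyHomogeneous n F)
    {a b c d : ℝ} (ha : 0 ≤ a) (hb : 0 ≤ b) (hc : 0 ≤ c) (hd : d ≤ 0) (y : En n) :
    F (hess n (gaussPair n a b c d) y) ≤
    c * Real.exp (-a * ‖y‖ ^ 2) * (-4 * a ^ 2 * (lam * ‖y‖ ^ 2) + 2 * a * (n * Lam)) +
      d * Real.exp (-b * ‖y‖ ^ 2) * (-4 * b ^ 2 * (Lam * ‖y‖ ^ 2)) := by
  refine (pucci_bounds hLam hF hFh (isSymm_hess_gaussPair n a b c d y) _).2 fun A hA => ?_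
  rw [trace_mul_hess_gaussPair]
  have h1 := dotProduct_mulVec_mem_Icc hA y
  have h2 : 0 ≤ A.trace := le_trans (by positivity) (trace_mem_Icc hA).1
  have h3 := (trace_mem_Icc hA).2
  refine add_le_add (mul_le_mul_of_nonneg_left ?_ (by positivity))
    (mul_le_mul_of_nonpos_left ?_ (mul_nonpos_of_nonpos_of_nonneg hd (by positivity)))
  · have := mul_le_mul_of_nonneg_left h1.1 (by positivity : 0 ≤ 4 * a ^ 2)
    have := mul_le_mul_of_nonneg_left h3 (by positivity : 0 ≤ 2 * a)
    linarith
  · have := mul_le_mul_of_nonneg_left h1.2 (by positivity : 0 ≤ 4 * b ^ 2)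
    have : 0 ≤ 2 * b * A.trace := by positivity
    linarith

theorem fderiv_gaussPair_self (n : ℕ) (a b c d : ℝ) (y : En n) :
    fderiv ℝ (gaussPair n a b c d) y y =
      c * Real.exp (-a * ‖y‖ ^ 2) * (-2 * a * ‖y‖ ^ 2) +
        d * Real.exp (-b * ‖y‖ ^ 2) * (-2 * b * ‖y‖ ^ 2) := by
  rw [fderiv_gaussPair, real_inner_self_eq_norm_sq]
  ring

theorem exists_radius {k : ℝ} (hk : 0 < k) (l : ℝ) :
    ∃ R : ℝ, 0 ≤ R ∧ ∀ r : ℝ, R < r → 0 < k * r ^ 2 - l := by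
  refine ⟨max 1 (l / k), by positivity, fun r hr => ?_⟩
  obtain ⟨h1, h2⟩ := max_lt_iff.1 hr
  rw [div_lt_iff₀ hk] at h2
  nlinarith [mul_pos hk (by linarith : 0 < r),
    mul_pos (mul_pos hk (by linarith : 0 < r)) (by linarith : 0 < r - 1)]

theorem tendsto_exp_norm_sq_cocompact {n : ℕ} {c : ℝ} (hc : 0 < c) :
    Tendsto (fun y : En n => Real.exp (-c * ‖y‖ ^ 2)) (cocompact (En n)) (𝓝 0) := by
  have h1 : Tendsto (fun y : En n => ‖y‖ ^ 2) (cocompact (En n)) atTop :=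
    (tendsto_pow_atTop two_ne_zero).comp (tendsto_norm_cocompact_atTop (E := En n))
  exact Real.tendsto_exp_atBot.comp (h1.const_mul_atTop_of_neg (by linarith))

/-- Functions in `X` are bounded by slightly wider Gaussians. -/
theorem memX.exists_le_exp {n : ℕ} {b c : ℝ} {u : En n → ℝ} (hu : memX n b u) (hc : c < b) :
    ∃ K : ℝ, 0 < K ∧ ∀ y, u y ≤ K * Real.exp (-c * ‖y‖ ^ 2) := by
  obtain ⟨K, hK⟩ := hu.2
  have hK : ∀ y, |u y| * Real.exp (b * ‖y‖ ^ 2) / (1 + ‖y‖ ^ 2) ≤ K :=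
    fun y => hK ⟨y, rfl⟩
  have hK0 : 0 ≤ K := le_trans (by positivity) (hK 0)
  have hbc : 0 < b - c := sub_pos.2 hc
  refine ⟨K * (1 + 1 / (b - c)) + 1, by positivity, fun y => ?_⟩
  have h1 := hK y
  rw [div_le_iff₀ (by positivity)] at h1
  have h2 : 1 + ‖y‖ ^ 2 ≤ (1 + 1 / (b - c)) * Real.exp ((b - c) * ‖y‖ ^ 2) := by
    have h3 := Real.add_one_le_exp ((b - c) * ‖y‖ ^ 2)
    have h4 : (1 + 1 / (b - c)) * ((b - c) * ‖y‖ ^ 2 + 1) ≤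
        (1 + 1 / (b - c)) * Real.exp ((b - c) * ‖y‖ ^ 2) := by gcongr
    refine le_trans ?_ h4
    have : (1 + 1 / (b - c)) * ((b - c) * ‖y‖ ^ 2 + 1) =
      1 + ‖y‖ ^ 2 + ((b - c) * ‖y‖ ^ 2 + 1 / (b - c)) := by field_simp; ring
    rw [this]
    have : 0 ≤ (b - c) * ‖y‖ ^ 2 + 1 / (b - c) := by positivity
    linarith
  have h5 : u y * Real.exp (b * ‖y‖ ^ 2) ≤
      (K * (1 + 1 / (b - c)) + 1) * Real.exp (-c * ‖y‖ ^ 2) * Real.exp (b * ‖y‖ ^ 2) := by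
    calc u y * Real.exp (b * ‖y‖ ^ 2) ≤ |u y| * Real.exp (b * ‖y‖ ^ 2) := by
          gcongr; exact le_abs_self _
      _ ≤ K * (1 + ‖y‖ ^ 2) := h1
      _ ≤ K * ((1 + 1 / (b - c)) * Real.exp ((b - c) * ‖y‖ ^ 2)) := by gcongr
      _ ≤ (K * (1 + 1 / (b - c)) + 1) * Real.exp ((b - c) * ‖y‖ ^ 2) := by
          rw [← mul_assoc]; gcongr; linarith
      _ = _ := by rw [mul_assoc _ (Real.exp _), ← Real.exp_add]; ring_nf
  exact le_of_mul_le_mul_right h5 (Real.exp_pos _)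

theorem continuous_gaussPair (n : ℕ) (a b c d : ℝ) : Continuous (gaussPair n a b c d) :=
  (contDiff_gaussPair n a b c d).continuous

theorem gaussPair_smul (n : ℕ) (a b c d t : ℝ) (y : En n) :
    gaussPair n a b (t * c) (t * d) y = t * gaussPair n a b c d y := by
  unfold gaussPair; ring

/-- Gaussian upper bound for positive subsolutions in `X`. -/
theorem exists_le_exp_of_viscSubE {n : ℕ} {lam Lam : ℝ} (hlam : 0 < lam) (hLam : lam ≤ Lam)
    {F : Mat n → ℝ} (hF : UniformlyElliptic n lam Lam F) (hFh : PositivelyHomogeneous n F)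
    {α : ℝ} {u : En n → ℝ} (hmem : memX n (1 / (8 * Lam)) u) (hpos : ∀ y, 0 < u y)
    (hu : ViscSubE n Set.univ (Fop n F α (fun _ => 0)) u) {a : ℝ} (ha : 0 < a)
    (haL : a < 1 / (4 * Lam)) :
    ∃ C : ℝ, 0 < C ∧ ∀ y : En n, u y ≤ C * Real.exp (-a * ‖y‖ ^ 2) := by
  have hL : 0 < Lam := hlam.trans_le hLam
  obtain ⟨b, hb, hb8⟩ : ∃ b : ℝ, 0 < b ∧ b < 1 / (8 * Lam) := exists_between (by positivity)
  obtain ⟨e, heb, he8⟩ := exists_between hb8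
  have hb4 : 4 * b * Lam < 1 := by
    rw [lt_div_iff₀ (by positivity)] at hb8
    nlinarith [mul_pos hb hL]
  have ha4 : 4 * a * Lam < 1 := by
    rw [lt_div_iff₀ (by positivity)] at haL
    linarith
  obtain ⟨R₁, hR₁, h₁⟩ := exists_radius (mul_pos ha (sub_pos.2 ha4)) α
  obtain ⟨R₂, hR₂, h₂⟩ := exists_radius (mul_pos hb (sub_pos.2 hb4)) α
  obtain ⟨K, hK, huK⟩ := hmem.exists_le_exp he8
  have he : 0 < e := hb.trans heb
  set R := max R₁ R₂
  have huK' : ∀ y, u y ≤ K := fun y => (huK y).trans <| by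
    have : Real.exp (-e * ‖y‖ ^ 2) ≤ 1 := Real.exp_le_one_iff.2 (by nlinarith [sq_nonneg ‖y‖])
    nlinarith
  have main : ∀ ε : ℝ, 0 < ε → ∀ y, u y ≤ K * Real.exp (a * R ^ 2) * gaussPair n a b 1 ε y := by
    intro ε hε
    have hg : ∀ y, 0 < gaussPair n a b 1 ε y := fun y => by unfold gaussPair; positivity
    have hlim : ∀ᶠ y in cocompact (En n),
        u y / gaussPair n a b 1 ε y ≤ u 0 / gaussPair n a b 1 ε 0 := by
      have h := (tendsto_exp_norm_sq_cocompact (n := n) (sub_pos.2 heb)).const_mul (K / ε)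
      rw [mul_zero] at h
      filter_upwards [h.eventually_lt_const (div_pos (hpos 0) (hg 0))] with y hy
      refine le_trans ?_ hy.le
      rw [div_le_iff₀ (hg y)]
      refine (huK y).trans ?_
      have : K * Real.exp (-e * ‖y‖ ^ 2) =
          K / ε * Real.exp (-(e - b) * ‖y‖ ^ 2) * (ε * Real.exp (-b * ‖y‖ ^ 2)) := by
        have : Real.exp (-e * ‖y‖ ^ 2) =
            Real.exp (-(e - b) * ‖y‖ ^ 2) * Real.exp (-b * ‖y‖ ^ 2) := by
          rw [← Real.exp_add]; ring_nf
        rw [this]; field_simp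
      rw [this]
      refine mul_le_mul_of_nonneg_left ?_ (by positivity)
      unfold gaussPair
      have := Real.exp_pos (-a * ‖y‖ ^ 2)
      linarith
    obtain ⟨y₀, hy₀⟩ := (hmem.1.div (continuous_gaussPair n a b 1 ε)
      fun y => (hg y).ne').exists_forall_ge' 0 hlim
    set t := u y₀ / gaussPair n a b 1 ε y₀ with ht
    have ht0 : 0 < t := div_pos (hpos _) (hg _)
    have hle : ∀ y, u y ≤ t * gaussPair n a b 1 ε y := fun y =>
      (div_le_iff₀ (hg y)).1 (hy₀ y)
    have heq : u y₀ = t * gaussPair n a b 1 ε y₀ := by rw [ht, div_mul_cancel₀ _ (hg _).ne']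
    have hyR : ‖y₀‖ ≤ R := by
      by_contra! hlt
      have hmax := hu y₀ (Set.mem_univ _) (gaussPair n a b (t * 1) (t * ε))
        (contDiff_gaussPair n a b _ _) (Filter.Eventually.of_forall fun y => by
          simp only [gaussPair_smul]
          linarith [hle y])
      have hFle := le_elliptic_gaussPair hlam hLam hF hFh ha.le hb.le
        (by positivity : 0 ≤ t * 1) (by positivity : 0 ≤ t * ε) y₀
      simp only [Fop, fderiv_gaussPair_self] at hmax
      have p₁ := mul_pos (by positivity : 0 < t * 1 * Real.exp (-a * ‖y₀‖ ^ 2))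
        (h₁ ‖y₀‖ ((le_max_left _ _).trans_lt hlt))
      have p₂ := mul_pos (by positivity : 0 < t * ε * Real.exp (-b * ‖y₀‖ ^ 2))
        (h₂ ‖y₀‖ ((le_max_right _ _).trans_lt hlt))
      rw [heq, ← gaussPair_smul, gaussPair] at hmax
      linarith
    have htC : t ≤ K * Real.exp (a * R ^ 2) := by
      rw [ht, div_le_iff₀ (hg _)]
      have h3 : 1 ≤ Real.exp (a * R ^ 2) * gaussPair n a b 1 ε y₀ := by
        calc (1 : ℝ) ≤ Real.exp (a * R ^ 2 + -a * ‖y₀‖ ^ 2) := by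
              apply Real.one_le_exp
              have : ‖y₀‖ ^ 2 ≤ R ^ 2 := by gcongr
              nlinarith
          _ = Real.exp (a * R ^ 2) * Real.exp (-a * ‖y₀‖ ^ 2) := Real.exp_add _ _
          _ ≤ _ := by
              gcongr
              unfold gaussPair
              have := mul_pos hε (Real.exp_pos (-b * ‖y₀‖ ^ 2))
              linarith
      calc u y₀ ≤ K * 1 := by rw [mul_one]; exact huK' y₀
        _ ≤ K * (Real.exp (a * R ^ 2) * gaussPair n a b 1 ε y₀) := by gcongr
        _ = _ := by ring
    intro y
    exact (hle y).trans (mul_le_mul_of_nonneg_right htC (hg y).le)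
  refine ⟨K * Real.exp (a * R ^ 2), by positivity, fun y => ?_⟩
  have hc : Continuous fun ε : ℝ => K * Real.exp (a * R ^ 2) * gaussPair n a b 1 ε y := by
    unfold gaussPair; fun_prop
  have h := ge_of_tendsto (hc.continuousWithinAt (s := Set.Ioi 0) (x := 0)).tendsto
    (eventually_nhdsWithin_of_forall fun ε hε => main ε hε y)
  simpa [gaussPair] using h

/-- Gaussian lower bound for positive supersolutions. -/
theorem exists_exp_le_of_viscSupE {n : ℕ} {lam Lam : ℝ} (hlam : 0 < lam) (hLam : lam ≤ Lam)
    {F : Mat n → ℝ} (hF : UniformlyElliptic n lam Lam F) (hFh : PositivelyHomogeneous n F)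
    {α : ℝ} {u : En n → ℝ} (hcont : Continuous u) (hpos : ∀ y, 0 < u y)
    (hu : ViscSupE n Set.univ (Fop n F α (fun _ => 0)) u) {a : ℝ}
    (haL : 1 / (4 * lam) < a) :
    ∃ C : ℝ, 0 < C ∧ ∀ y : En n, Real.exp (-a * ‖y‖ ^ 2) ≤ C * u y := by
  have hL : 0 < Lam := hlam.trans_le hLam
  have ha : 0 < a := lt_trans (by positivity) haL
  obtain ⟨b, hb, hbL⟩ : ∃ b : ℝ, 0 < b ∧ b < 1 / (4 * Lam) := exists_between (by positivity)
  have hba : b < a := hbL.trans (lt_of_le_of_lt (by gcongr) haL)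
  have hb4 : 4 * b * Lam < 1 := by
    rw [lt_div_iff₀ (by positivity)] at hbL
    linarith
  have ha4 : 1 < 4 * a * lam := by
    rw [div_lt_iff₀ (by positivity)] at haL
    linarith
  obtain ⟨R₁, hR₁, h₁⟩ := exists_radius (mul_pos ha (sub_pos.2 ha4)) (2 * a * (n * Lam) - α)
  obtain ⟨R₂, hR₂, h₂⟩ := exists_radius (mul_pos hb (sub_pos.2 hb4)) α
  set R := max R₁ R₂
  have hR : 0 ≤ R := hR₁.trans (le_max_left _ _)
  obtain ⟨x, -, hx⟩ := (isCompact_closedBall (0 : En n) R).exists_isMinOn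
    ⟨0, by simpa using hR⟩ hcont.continuousOn
  have main : ∀ ε ∈ Set.Ioo (0 : ℝ) 1, ∀ y, gaussPair n a b 1 (-ε) y ≤ (u x)⁻¹ * u y := by
    rintro ε ⟨hε, hε1⟩
    have hg0 : 0 < gaussPair n a b 1 (-ε) 0 := by simp [gaussPair, hε1]
    have hlim : ∀ᶠ y in cocompact (En n),
        gaussPair n a b 1 (-ε) y / u y ≤ gaussPair n a b 1 (-ε) 0 / u 0 := by
      filter_upwards [(tendsto_exp_norm_sq_cocompact (n := n)
        (sub_pos.2 hba)).eventually_lt_const hε] with y hy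
      refine le_trans (div_nonpos_of_nonpos_of_nonneg ?_ (hpos y).le) (div_pos hg0 (hpos 0)).le
      have : Real.exp (-a * ‖y‖ ^ 2) =
          Real.exp (-(a - b) * ‖y‖ ^ 2) * Real.exp (-b * ‖y‖ ^ 2) := by
        rw [← Real.exp_add]; ring_nf
      unfold gaussPair
      rw [this]
      nlinarith [mul_lt_mul_of_pos_right hy (Real.exp_pos (-b * ‖y‖ ^ 2))]
    obtain ⟨y₀, hy₀⟩ := ((continuous_gaussPair n a b 1 (-ε)).div hcont
      fun y => (hpos y).ne').exists_forall_ge' 0 hlim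
    set t := gaussPair n a b 1 (-ε) y₀ / u y₀ with ht
    have ht0 : 0 < t := (div_pos hg0 (hpos 0)).trans_le (hy₀ 0)
    have hle : ∀ y, gaussPair n a b 1 (-ε) y ≤ t * u y := fun y =>
      (div_le_iff₀ (hpos y)).1 (hy₀ y)
    have heq : gaussPair n a b 1 (-ε) y₀ = t * u y₀ := by rw [ht, div_mul_cancel₀ _ (hpos _).ne']
    have heq' : u y₀ = t⁻¹ * gaussPair n a b 1 (-ε) y₀ := by rw [heq]; field_simp
    have hle' : ∀ y, t⁻¹ * gaussPair n a b 1 (-ε) y ≤ u y := fun y => by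
      rw [inv_mul_le_iff₀ ht0]; exact hle y
    have hyR : ‖y₀‖ ≤ R := by
      by_contra! hlt
      have hmin := hu y₀ (Set.mem_univ _) (gaussPair n a b (t⁻¹ * 1) (t⁻¹ * -ε))
        (contDiff_gaussPair n a b _ _) (Filter.Eventually.of_forall fun y => by
          simp only [gaussPair_smul]
          linarith [hle' y])
      have hi : 0 < t⁻¹ := inv_pos.2 ht0
      have hFle := elliptic_gaussPair_le hlam hLam hF hFh ha.le hb.le
        (by positivity : 0 ≤ t⁻¹ * 1) (by nlinarith : t⁻¹ * -ε ≤ 0) y₀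
      simp only [Fop, fderiv_gaussPair_self] at hmin
      have p₁ := mul_pos (by positivity : 0 < t⁻¹ * 1 * Real.exp (-a * ‖y₀‖ ^ 2))
        (h₁ ‖y₀‖ ((le_max_left _ _).trans_lt hlt))
      have p₂ := mul_pos (by positivity : 0 < t⁻¹ * ε * Real.exp (-b * ‖y₀‖ ^ 2))
        (h₂ ‖y₀‖ ((le_max_right _ _).trans_lt hlt))
      rw [heq', ← gaussPair_smul, gaussPair] at hmin
      linarith
    have htC : t ≤ (u x)⁻¹ := by
      have h1 : gaussPair n a b 1 (-ε) y₀ ≤ 1 := by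
        have h3 : Real.exp (-a * ‖y₀‖ ^ 2) ≤ 1 :=
          Real.exp_le_one_iff.2 (by nlinarith [sq_nonneg ‖y₀‖])
        have := mul_pos hε (Real.exp_pos (-b * ‖y₀‖ ^ 2))
        unfold gaussPair
        linarith
      have h2 : u x ≤ u y₀ := hx (by simpa using hyR)
      rw [ht, ← one_div]
      exact div_le_div₀ zero_le_one h1 (hpos x) h2
    intro y
    exact (hle y).trans (mul_le_mul_of_nonneg_right htC (hpos y).le)
  refine ⟨(u x)⁻¹, inv_pos.2 (hpos x), fun y => ?_⟩
  have hc : Continuous fun ε : ℝ => gaussPair n a b 1 (-ε) y := by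
    unfold gaussPair; fun_prop
  have h := le_of_tendsto (hc.continuousWithinAt (s := Set.Ioi 0) (x := 0)).tendsto
    (by filter_upwards [Ioo_mem_nhdsGT zero_lt_one] with ε hε using main ε hε y)
  simpa [gaussPair] using h

/-- **Lemma 3.9.** Gaussian bounds for the principal eigenfunction: `φ⁺(y) ≤ C e^{-a|y|²}` for
every `a < 1/(4Λ)`, and `e^{-a|y|²} ≤ C φ⁺(y)` for every `a > 1/(4λ)`. -/
theorem bound_above_and_below (n : ℕ) (hn : 1 ≤ n) (lam Lam : ℝ)
    (hlam : 0 < lam) (hLam : lam ≤ Lam)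
    (F : Mat n → ℝ) (hF : UniformlyElliptic n lam Lam F) (hFh : PositivelyHomogeneous n F)
    (φp : En n → ℝ) (hmem : memX n (1/(8*Lam)) φp) (h0 : φp 0 = 1) (hpos : ∀ y, 0 < φp y)
    (hsol : ViscSolE n Set.univ (Fop n F (alphaPlus n lam Lam F) (fun _ => 0)) φp) :
    (∀ a : ℝ, 0 < a → a < 1/(4*Lam) →
      ∃ C : ℝ, 0 < C ∧ ∀ y : En n, φp y ≤ C * Real.exp (-a * ‖y‖ ^ 2)) ∧
    (∀ a : ℝ, 1/(4*lam) < a →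
      ∃ C : ℝ, 0 < C ∧ ∀ y : En n, Real.exp (-a * ‖y‖ ^ 2) ≤ C * φp y) := by
  exact ⟨fun a ha haL => exists_le_exp_of_viscSubE hlam hLam hF hFh hmem hpos hsol.1 ha haL,
    fun a haL => exists_exp_le_of_viscSupE hlam hLam hF hFh hmem.1 hpos hsol.2 haL⟩
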